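/- arXiv:2112.02804 — 3 statements merged into one kernel-verified Lean document; each statement's English description precedes it below -/
import Mathlib

section
/- For every real x̃ with −maxF ≤ x̃ ≤ maxF, the set { y ∈ F : x̃ ≤ y } is nonempty, and its least element g satisfies x̃ ≤ g ≤ x̃ + (|x̃|/ed + em). -/
noncomputable section

/-- The maximum exponent `e_max = 2^(eb-1) - 1`, as an integer. -/
def emax (eb : ℕ) : ℤ := 2 ^ (eb - 1) - 1

/-- The set of finite floating-point numbers
`F = { M · 2^(e - sb + 1) : M, e ∈ ℤ, |M| ≤ 2^sb - 1, 1 - e_max ≤ e ≤ e_max }`. -/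
def Fset (eb sb : ℕ) : Set ℝ :=
  {x | ∃ M e : ℤ, |M| ≤ 2 ^ sb - 1 ∧ 1 - emax eb ≤ e ∧ e ≤ emax eb ∧
    x = (M : ℝ) * (2 : ℝ) ^ (e - (sb : ℤ) + 1)}

/-- `ed = 2^(sb-1)`. -/
def edc (sb : ℕ) : ℝ := 2 ^ (sb - 1)

/-- `em = (ed - 1) / (2^(e_max - 1) · ed)`. -/
def emc (eb sb : ℕ) : ℝ := (edc sb - 1) / ((2 : ℝ) ^ (emax eb - 1) * edc sb)

/-- The largest finite floating-point number `maxF = (2^sb - 1) · 2^(e_max - sb + 1)`. -/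
def maxF (eb sb : ℕ) : ℝ := ((2 : ℝ) ^ sb - 1) * (2 : ℝ) ^ (emax eb - (sb : ℤ) + 1)

/-- The downward rounding approximation `D(x) = x - |x|/ed - em`. -/
def Dr (eb sb : ℕ) (x : ℝ) : ℝ := x - |x| / edc sb - emc eb sb

/-- The upward rounding approximation `U(x) = x + |x|/ed + em`. -/
def Ur (eb sb : ℕ) (x : ℝ) : ℝ := x + |x| / edc sb + emc eb sb

/-- `z` is a directed rounding of `x`: the greatest element of `F` below `x`
or the least element of `F` above `x`. -/
def DirRound (eb sb : ℕ) (x z : ℝ) : Prop :=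
  IsGreatest {y ∈ Fset eb sb | y ≤ x} z ∨ IsLeast {y ∈ Fset eb sb | x ≤ y} z

theorem Fset_finite (eb sb : ℕ) : (Fset eb sb).Finite := by
  have h : ((Set.Icc (-(2 ^ sb - 1) : ℤ) (2 ^ sb - 1)) ×ˢ
      (Set.Icc (1 - emax eb) (emax eb))).Finite := (Set.finite_Icc _ _).prod (Set.finite_Icc _ _)
  refine (h.image (fun p : ℤ × ℤ => (p.1 : ℝ) * (2 : ℝ) ^ (p.2 - (sb : ℤ) + 1))).subset ?_
  rintro x ⟨M, e, hM, h1, h2, rfl⟩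
  exact ⟨(M, e), ⟨abs_le.mp hM, h1, h2⟩, rfl⟩

theorem step_lem (eb sb : ℕ) (hsb : 2 ≤ sb) (x : ℝ) (hx : |x| ≤ maxF eb sb) (e : ℤ)
    (h1 : 1 - emax eb ≤ e) (h2 : e ≤ emax eb) (hlt : |x| < (2 : ℝ) ^ (e + 1)) :
    ∃ y ∈ Fset eb sb, x ≤ y ∧ y ≤ x + (2 : ℝ) ^ (e - (sb : ℤ) + 1) := by
  set u : ℝ := (2 : ℝ) ^ (e - (sb : ℤ) + 1) with hu
  have hu0 : 0 < u := by positivity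
  have hpow : (2 : ℝ) ^ (e + 1) = 2 ^ sb * u := by
    rw [hu, ← zpow_natCast, ← zpow_add₀ (by norm_num)]
    congr 1; ring
  set M : ℤ := ⌈x / u⌉ with hM
  have hMx : x ≤ M * u := by
    rw [← div_le_iff₀ hu0]; exact Int.le_ceil _
  have hMx' : M * u ≤ x + u := by
    have := (Int.ceil_lt_add_one (x / u)).le
    have h3 : (M : ℝ) ≤ (x + u) / u := by
      rw [add_div, div_self hu0.ne']; exact this
    rwa [le_div_iff₀ hu0] at h3
  obtain ⟨hl, hr⟩ := abs_lt.mp hlt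
  have hMl : -(2 ^ sb : ℤ) < M := by
    rw [hM, Int.lt_ceil, lt_div_iff₀ hu0]
    push_cast; linarith
  have hMr : M ≤ (2 ^ sb : ℤ) := by
    rw [hM, Int.ceil_le, div_le_iff₀ hu0]
    push_cast; linarith
  rcases hMr.lt_or_eq with h | h
  · exact ⟨M * u, ⟨M, e, abs_le.mpr ⟨by omega, by omega⟩, h1, h2, rfl⟩, hMx, hMx'⟩
  · have hne : e ≠ emax eb := by
      intro he
      have : M ≤ (2 ^ sb : ℤ) - 1 := by
        rw [hM, Int.ceil_le, div_le_iff₀ hu0]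
        push_cast
        have := (le_abs_self x).trans hx
        rw [maxF, ← he] at this
        exact this
      omega
    refine ⟨M * u, ⟨2 ^ (sb - 1), e + 1, ?_, by omega, by omega, ?_⟩, hMx, hMx'⟩
    · obtain ⟨k, rfl⟩ : ∃ k, sb = k + 1 := ⟨sb - 1, by omega⟩
      have : (1 : ℤ) ≤ 2 ^ k := one_le_pow₀ (by norm_num)
      rw [abs_of_nonneg (by positivity), Nat.add_sub_cancel, pow_succ]
      omega
    · rw [h]
      obtain ⟨k, rfl⟩ : ∃ k, sb = k + 1 := ⟨sb - 1, by omega⟩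
      rw [Nat.add_sub_cancel, show e + 1 - ((k + 1 : ℕ) : ℤ) + 1 = (e - ((k + 1 : ℕ) : ℤ) + 1) + 1 by ring,
        zpow_add_one₀ (by norm_num), ← hu]
      push_cast
      ring

theorem cand (eb sb : ℕ) (heb : 2 ≤ eb) (hsb : 2 ≤ sb) (x : ℝ) (hx : |x| ≤ maxF eb sb) :
    ∃ y ∈ Fset eb sb, x ≤ y ∧ y ≤ x + (|x| / edc sb + emc eb sb) := by
  have hem : 1 ≤ emax eb := by
    have : (2 : ℤ) ^ 1 ≤ 2 ^ (eb - 1) := pow_le_pow_right₀ (by norm_num) (by omega)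
    unfold emax; omega
  have hed : 2 ≤ edc sb := by
    have : (2 : ℝ) ^ 1 ≤ 2 ^ (sb - 1) := pow_le_pow_right₀ (by norm_num) (by omega)
    unfold edc; linarith
  have hu : ∀ e : ℤ, (2 : ℝ) ^ (e - (sb : ℤ) + 1) = 2 ^ e / edc sb := by
    intro e
    rw [edc, ← zpow_natCast, ← zpow_sub₀ (by norm_num)]
    congr 1
    push_cast [Nat.cast_sub (show 1 ≤ sb by omega)]
    ring
  have hemc : emc eb sb = (2 : ℝ) ^ (1 - emax eb) * (edc sb - 1) / edc sb := by
    rw [emc, show 1 - emax eb = -(emax eb - 1) by ring, zpow_neg]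
    field_simp
  have hp : (0 : ℝ) < (2 : ℝ) ^ (1 - emax eb) := by positivity
  by_cases hc : |x| < (2 : ℝ) ^ (1 - emax eb)
  · obtain ⟨y, hy, hy1, hy2⟩ := step_lem eb sb hsb x hx (1 - emax eb) le_rfl (by omega)
      (hc.trans (zpow_lt_zpow_right₀ (by norm_num) (by omega)))
    refine ⟨y, hy, hy1, hy2.trans ?_⟩
    rw [hu, hemc]
    have : (2 : ℝ) ^ (1 - emax eb) / edc sb ≤ (2 : ℝ) ^ (1 - emax eb) * (edc sb - 1) / edc sb := by
      gcongr
      nlinarith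
    have : 0 ≤ |x| / edc sb := by positivity
    linarith
  · push Not at hc
    have hx0 : 0 < |x| := hp.trans_le hc
    have ha : (2 : ℝ) ^ (Int.log 2 |x|) ≤ |x| := by
      exact_mod_cast Int.zpow_log_le_self (b := 2) (by norm_num) hx0
    have hb : |x| < (2 : ℝ) ^ (Int.log 2 |x| + 1) := by
      exact_mod_cast Int.lt_zpow_succ_log_self (b := 2) (by norm_num) |x|
    have h1 : 1 - emax eb ≤ Int.log 2 |x| := by
      have := (zpow_lt_zpow_iff_right₀ (by norm_num : (1:ℝ) < 2)).mp (hc.trans_lt hb)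
      omega
    have h2 : Int.log 2 |x| ≤ emax eb := by
      have hm : maxF eb sb < (2 : ℝ) ^ (emax eb + 1) := by
        have : (2 : ℝ) ^ (emax eb + 1) = 2 ^ sb * (2 : ℝ) ^ (emax eb - (sb : ℤ) + 1) := by
          rw [← zpow_natCast, ← zpow_add₀ (by norm_num)]
          congr 1; ring
        rw [this, maxF]
        gcongr
        linarith
      have := (zpow_lt_zpow_iff_right₀ (by norm_num : (1:ℝ) < 2)).mp ((ha.trans hx).trans_lt hm)
      omega
    obtain ⟨y, hy, hy1, hy2⟩ := step_lem eb sb hsb x hx _ h1 h2 hb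
    refine ⟨y, hy, hy1, hy2.trans ?_⟩
    rw [hu, hemc]
    have : (2 : ℝ) ^ (Int.log 2 |x|) / edc sb ≤ |x| / edc sb := by gcongr
    have : 0 ≤ (2 : ℝ) ^ (1 - emax eb) * (edc sb - 1) / edc sb :=
      div_nonneg (mul_nonneg hp.le (by linarith)) (by linarith)
    linarith

theorem stmt1 (eb sb : ℕ) (heb : 2 ≤ eb) (hsb : 2 ≤ sb)
    (x : ℝ) (hx1 : -maxF eb sb ≤ x) (hx2 : x ≤ maxF eb sb) :
    {y ∈ Fset eb sb | x ≤ y}.Nonempty ∧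
      ∃ g, IsLeast {y ∈ Fset eb sb | x ≤ y} g ∧
        x ≤ g ∧ g ≤ x + (|x| / edc sb + emc eb sb) := by
  obtain ⟨y, hy, hxy, hyb⟩ := cand eb sb heb hsb x (abs_le.mpr ⟨hx1, hx2⟩)
  have hne : {y ∈ Fset eb sb | x ≤ y}.Nonempty := ⟨y, hy, hxy⟩
  have hfin : {y ∈ Fset eb sb | x ≤ y}.Finite := (Fset_finite eb sb).subset (fun _ h => h.1)
  obtain ⟨g, hg, hmin⟩ := Set.exists_min_image _ id hfin hne
  exact ⟨hne, g, ⟨hg, fun z hz => hmin z hz⟩, hg.2, (hmin y ⟨hy, hxy⟩).trans hyb⟩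
end
end

section
/- (Interval extension of floating-point addition, Lemma 2 for +) Let x̲ ≤ x ≤ x̄ and y̲ ≤ y ≤ ȳ be real numbers, suppose −maxF ≤ x + y ≤ maxF, and let z be any directed rounding of x + y (hence the result of the floating-point addition of any two floating-point operands lying in [x̲, x̄] and [y̲, ȳ], under any rounding mode, provided it does not overflow). Then D(x̲ + y̲) ≤ z ≤ U(x̄ + ȳ). -/
noncomputable section

lemma key_aux (eb sb : ℕ) (hsb : 2 ≤ sb) (s : ℝ) (e : ℤ) (h1 : 1 - emax eb ≤ e)
    (h2 : e ≤ emax eb) (hs : |s| ≤ maxF eb sb) (hlt : |s| < (2:ℝ) ^ (e + 1)) :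
    ∃ f ∈ Fset eb sb, f ≤ s ∧ s - (2:ℝ) ^ (e - (sb:ℤ) + 1) ≤ f := by
  set q : ℝ := (2:ℝ) ^ (e - (sb:ℤ) + 1) with hq
  have hq0 : 0 < q := by positivity
  have hqe : (2:ℝ) ^ (e + 1) = 2 ^ sb * q := by
    rw [hq, ← zpow_natCast, ← zpow_add₀ (by norm_num)]; congr 1; ring
  have hMq : (⌊s / q⌋ : ℝ) * q ≤ s := by
    have := Int.floor_le (s / q)
    rwa [le_div_iff₀ hq0] at this
  have hMq2 : s - q ≤ (⌊s / q⌋ : ℝ) * q := by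
    have := Int.lt_floor_add_one (s / q)
    rw [div_lt_iff₀ hq0] at this
    linarith
  rw [hqe] at hlt
  obtain ⟨ha, hb⟩ := abs_lt.mp hlt
  have hup : ⌊s / q⌋ < 2 ^ sb := by
    rw [Int.floor_lt]; push_cast
    rw [div_lt_iff₀ hq0]; exact hb
  have hlo : -2 ^ sb ≤ ⌊s / q⌋ := by
    rw [Int.le_floor]; push_cast
    rw [le_div_iff₀ hq0]; linarith
  refine ⟨(⌊s / q⌋ : ℝ) * q, ?_, hMq, hMq2⟩
  by_cases hM : ⌊s / q⌋ = -2 ^ sb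
  · by_cases he : e = emax eb
    · exfalso
      have : -(2 ^ sb - 1) ≤ ⌊s / q⌋ := by
        rw [Int.le_floor]; push_cast
        rw [le_div_iff₀ hq0]
        have := (abs_le.mp hs).1
        rw [maxF, ← he, ← hq] at this
        linarith
      omega
    · refine ⟨-2 ^ (sb - 1), e + 1, ?_, by omega, by omega, ?_⟩
      · rw [abs_neg, abs_of_nonneg (by positivity)]
        obtain ⟨k, rfl⟩ : ∃ k, sb = k + 1 := ⟨sb - 1, by omega⟩
        have : (1:ℤ) ≤ 2 ^ k := one_le_pow₀ (by norm_num)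
        simp only [Nat.add_sub_cancel, pow_succ]; linarith
      · rw [hM]
        have : (2:ℝ) ^ (e + 1 - (sb:ℤ) + 1) = 2 * q := by
          rw [hq, ← zpow_one_add₀ (by norm_num)]; congr 1; ring
        rw [this]
        obtain ⟨k, rfl⟩ : ∃ k, sb = k + 1 := ⟨sb - 1, by omega⟩
        simp only [Nat.add_sub_cancel, pow_succ]; push_cast; ring
  · refine ⟨⌊s / q⌋, e, ?_, h1, h2, rfl⟩
    rw [abs_le]; constructor <;> omega

lemma edc_two_le (sb : ℕ) (hsb : 2 ≤ sb) : 2 ≤ edc sb := by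
  unfold edc
  calc (2:ℝ) = 2 ^ 1 := by norm_num
    _ ≤ 2 ^ (sb - 1) := pow_le_pow_right₀ (by norm_num) (by omega)

lemma quant_eq (sb : ℕ) (hsb : 2 ≤ sb) (e : ℤ) :
    (2:ℝ) ^ (e - (sb:ℤ) + 1) = 2 ^ e / edc sb := by
  unfold edc
  rw [← zpow_natCast, ← zpow_sub₀ (by norm_num)]; congr 1
  push_cast [Nat.cast_sub (show 1 ≤ sb by omega)]; ring

lemma emc_ge (eb sb : ℕ) (hsb : 2 ≤ sb) :
    (2:ℝ) ^ (1 - emax eb) / edc sb ≤ emc eb sb := by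
  have h := edc_two_le sb hsb
  unfold emc
  have : (2:ℝ) ^ (1 - emax eb) = 1 / 2 ^ (emax eb - 1) := by
    rw [one_div, ← zpow_neg]; congr 1; ring
  rw [this, div_div]
  gcongr
  linarith

lemma exists_below (eb sb : ℕ) (heb : 2 ≤ eb) (hsb : 2 ≤ sb) (s : ℝ) (hs : |s| ≤ maxF eb sb) :
    ∃ f ∈ Fset eb sb, f ≤ s ∧ Dr eb sb s ≤ f := by
  have hE : 1 ≤ emax eb := by
    unfold emax
    have : (2:ℤ) ^ 1 ≤ 2 ^ (eb - 1) := pow_le_pow_right₀ (by norm_num) (by omega)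
    linarith
  have hed := edc_two_le sb hsb
  have hem := emc_ge eb sb hsb
  have hed0 : 0 < edc sb := by linarith
  have hem0 : 0 ≤ emc eb sb := le_trans (by positivity) hem
  have habs : 0 ≤ |s| / edc sb := by positivity
  unfold Dr
  by_cases hsm : |s| < (2:ℝ) ^ (1 - emax eb)
  · obtain ⟨f, hf, h1, h2⟩ := key_aux eb sb hsb s (1 - emax eb) le_rfl (by omega) hs
      (hsm.trans (zpow_lt_zpow_right₀ (by norm_num) (by omega)))
    rw [quant_eq sb hsb] at h2
    exact ⟨f, hf, h1, by linarith⟩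
  · push Not at hsm
    have hpos : 0 < |s| := lt_of_lt_of_le (by positivity) hsm
    have hl1 : (2:ℝ) ^ (Int.log 2 |s|) ≤ |s| := by
      exact_mod_cast Int.zpow_log_le_self (b := 2) (by norm_num) hpos
    have hl2 : |s| < (2:ℝ) ^ (Int.log 2 |s| + 1) := by
      exact_mod_cast Int.lt_zpow_succ_log_self (b := 2) (by norm_num) |s|
    have hmax : maxF eb sb < (2:ℝ) ^ (emax eb + 1) := by
      have : (2:ℝ) ^ (emax eb + 1) = 2 ^ sb * (2:ℝ) ^ (emax eb - (sb:ℤ) + 1) := by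
        rw [← zpow_natCast, ← zpow_add₀ (by norm_num)]; congr 1; ring
      rw [this, maxF]
      gcongr
      linarith
    have e1 : 1 - emax eb < Int.log 2 |s| + 1 :=
      (zpow_lt_zpow_iff_right₀ (by norm_num : (1:ℝ) < 2)).mp (hsm.trans_lt hl2)
    have e2 : Int.log 2 |s| < emax eb + 1 :=
      (zpow_lt_zpow_iff_right₀ (by norm_num : (1:ℝ) < 2)).mp
        (hl1.trans_lt (hs.trans_lt hmax))
    obtain ⟨f, hf, h1, h2⟩ := key_aux eb sb hsb s (Int.log 2 |s|) (by omega) (by omega) hs hl2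
    rw [quant_eq sb hsb] at h2
    have : (2:ℝ) ^ (Int.log 2 |s|) / edc sb ≤ |s| / edc sb := by gcongr
    exact ⟨f, hf, h1, by linarith⟩

lemma Fset_neg (eb sb : ℕ) (f : ℝ) (hf : f ∈ Fset eb sb) : -f ∈ Fset eb sb := by
  obtain ⟨M, e, h1, h2, h3, rfl⟩ := hf
  exact ⟨-M, e, by rwa [abs_neg], h2, h3, by push_cast; ring⟩

lemma Ur_eq (eb sb : ℕ) (s : ℝ) : Ur eb sb s = -Dr eb sb (-s) := by
  unfold Ur Dr; rw [abs_neg]; ring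

lemma Dr_mono (eb sb : ℕ) (hsb : 2 ≤ sb) {a b : ℝ} (h : a ≤ b) :
    Dr eb sb a ≤ Dr eb sb b := by
  have hed := edc_two_le sb hsb
  unfold Dr
  have h1 : |b| - |a| ≤ b - a := by
    have := abs_sub_abs_le_abs_sub b a
    rwa [abs_of_nonneg (sub_nonneg.mpr h)] at this
  have h2 : (|b| - |a|) / edc sb ≤ b - a := by
    rw [div_le_iff₀ (by linarith)]
    nlinarith
  rw [sub_div] at h2
  linarith

lemma Dr_le (eb sb : ℕ) (hsb : 2 ≤ sb) (s : ℝ) : Dr eb sb s ≤ s := by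
  have hed := edc_two_le sb hsb
  have hed0 : 0 < edc sb := by linarith
  have hem0 : 0 ≤ emc eb sb := le_trans (by positivity) (emc_ge eb sb hsb)
  have habs : 0 ≤ |s| / edc sb := by positivity
  unfold Dr; linarith

theorem stmt4 (eb sb : ℕ) (heb : 2 ≤ eb) (hsb : 2 ≤ sb)
    (xl x xu yl y yu : ℝ)
    (hx1 : xl ≤ x) (hx2 : x ≤ xu) (hy1 : yl ≤ y) (hy2 : y ≤ yu)
    (hs1 : -maxF eb sb ≤ x + y) (hs2 : x + y ≤ maxF eb sb)
    (z : ℝ) (hz : DirRound eb sb (x + y) z) :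
    Dr eb sb (xl + yl) ≤ z ∧ z ≤ Ur eb sb (xu + yu) := by
  have hs : |x + y| ≤ maxF eb sb := abs_le.mpr ⟨hs1, hs2⟩
  have m1 : Dr eb sb (xl + yl) ≤ Dr eb sb (x + y) := Dr_mono eb sb hsb (by linarith)
  have m2 : Dr eb sb (-(xu + yu)) ≤ Dr eb sb (-(x + y)) := Dr_mono eb sb hsb (by linarith)
  have d1 := Dr_le eb sb hsb (x + y)
  have d2 := Dr_le eb sb hsb (-(x + y))
  rw [Ur_eq]
  rcases hz with hz | hz
  · obtain ⟨f, hf, h1, h2⟩ := exists_below eb sb heb hsb (x + y) hs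
    have a1 := hz.2 ⟨hf, h1⟩
    have a2 := hz.1.2
    constructor <;> linarith
  · obtain ⟨f, hf, h1, h2⟩ := exists_below eb sb heb hsb (-(x + y)) (by rwa [abs_neg])
    have a1 := hz.2 ⟨Fset_neg eb sb f hf, by linarith⟩
    have a2 := hz.1.2
    constructor <;> linarith
end
end

section
/- (Interval extension of floating-point subtraction, Lemma 2 for −) Let x̲ ≤ x ≤ x̄ and y̲ ≤ y ≤ ȳ be real numbers, suppose −maxF ≤ x − y ≤ maxF, and let z be any directed rounding of x − y. Then D(x̲ − ȳ) ≤ z ≤ U(x̄ − y̲). -/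
noncomputable section

theorem aux_pow (sb : ℕ) (hsb : 2 ≤ sb) : ((2:ℝ)^sb) = 2 * edc sb ∧ 2 ≤ edc sb := by
  obtain ⟨n, rfl⟩ := Nat.exists_eq_add_of_le hsb
  have h1 : 2 + n - 1 = n + 1 := by omega
  have h2 : (1:ℝ) ≤ 2 ^ n := one_le_pow₀ (by norm_num)
  unfold edc
  rw [h1]
  constructor
  · ring
  · rw [pow_succ]; linarith

theorem aux_zpow (sb : ℕ) (hsb : 2 ≤ sb) (e : ℤ) :
    (2:ℝ)^(e - (sb:ℤ) + 1) = 2^e / edc sb := by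
  have h : e - (sb:ℤ) + 1 = e - ((sb - 1 : ℕ) : ℤ) := by omega
  rw [h, zpow_sub₀ (by norm_num), zpow_natCast]; rfl

theorem aux_em (eb sb : ℕ) :
    emc eb sb = (edc sb - 1) * ((2:ℝ)^(1 - emax eb) / edc sb) := by
  have h : (2:ℝ)^(1 - emax eb) = ((2:ℝ)^(emax eb - 1))⁻¹ := by
    rw [← zpow_neg]; congr 1; ring
  unfold emc
  rw [h, div_eq_mul_inv, mul_inv]; ring

theorem aux_emax (eb : ℕ) (heb : 2 ≤ eb) : 1 ≤ emax eb := by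
  obtain ⟨n, rfl⟩ := Nat.exists_eq_add_of_le heb
  have h1 : 2 + n - 1 = n + 1 := by omega
  have h2 : (1:ℤ) ≤ 2 ^ n := one_le_pow₀ (by norm_num)
  unfold emax
  rw [h1, pow_succ]; linarith

theorem aux_neg (eb sb : ℕ) (x : ℝ) (h : x ∈ Fset eb sb) : -x ∈ Fset eb sb := by
  obtain ⟨M, e, h1, h2, h3, rfl⟩ := h
  exact ⟨-M, e, by rwa [abs_neg], h2, h3, by push_cast; ring⟩

theorem aux_exp (eb sb : ℕ) (heb : 2 ≤ eb) (hsb : 2 ≤ sb) (w : ℝ) (hw : |w| ≤ maxF eb sb) :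
    ∃ e : ℤ, 1 - emax eb ≤ e ∧ e ≤ emax eb ∧ |w| ≤ 2^(e+1) ∧
      (2:ℝ)^e / edc sb ≤ |w| / edc sb + emc eb sb := by
  obtain ⟨hp, hd⟩ := aux_pow sb hsb
  have hE := aux_emax eb heb
  have hem := aux_em eb sb
  have hpos : (0:ℝ) < (2:ℝ)^(1 - emax eb) / edc sb := by positivity
  by_cases hc : |w| < (2:ℝ)^(1 - emax eb)
  · refine ⟨1 - emax eb, le_rfl, by omega, ?_, ?_⟩
    · refine hc.le.trans (zpow_le_zpow_right₀ (by norm_num) (by omega))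
    · have : 0 ≤ |w| / edc sb := by positivity
      rw [hem]; nlinarith
  · push Not at hc
    have hw0 : 0 < |w| := lt_of_lt_of_le (by positivity) hc
    have hl := Int.zpow_log_le_self (b := 2) (by norm_num) hw0
    have hu := Int.lt_zpow_succ_log_self (R := ℝ) (b := 2) (by norm_num) |w|
    push_cast at hl hu
    have hmax : |w| < (2:ℝ)^(emax eb + 1) := by
      refine hw.trans_lt ?_
      unfold maxF
      rw [aux_zpow sb hsb, hp, zpow_add₀ (by norm_num), zpow_one]
      have : (0:ℝ) < 2^(emax eb) := by positivity
      have h3 : (2 * edc sb - 1) * (2 ^ emax eb / edc sb) =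
        2 ^ emax eb * 2 - 2 ^ emax eb / edc sb := by field_simp
      rw [h3]
      have : (0:ℝ) < 2^(emax eb) / edc sb := by positivity
      linarith
    refine ⟨Int.log 2 |w|, ?_, ?_, hu.le, ?_⟩
    · have := (zpow_lt_zpow_iff_right₀ (by norm_num : (1:ℝ) < 2)).1 (hc.trans_lt hu)
      omega
    · have := (zpow_lt_zpow_iff_right₀ (by norm_num : (1:ℝ) < 2)).1 (hl.trans_lt hmax)
      omega
    · have h1 : (2:ℝ) ^ Int.log 2 |w| / edc sb ≤ |w| / edc sb := by gcongr
      have h2 : 0 ≤ emc eb sb := by rw [hem]; exact mul_nonneg (by linarith) hpos.le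
      linarith

theorem aux_mem (eb sb : ℕ) (heb : 2 ≤ eb) (hsb : 2 ≤ sb) (M e : ℤ)
    (h1 : 1 - emax eb ≤ e) (h2 : e ≤ emax eb) (hM : |M| ≤ 2 ^ sb)
    (hM' : e = emax eb → |M| ≤ 2 ^ sb - 1) :
    (M:ℝ) * (2:ℝ)^(e - (sb:ℤ) + 1) ∈ Fset eb sb := by
  by_cases hb : |M| ≤ 2^sb - 1
  · exact ⟨M, e, hb, h1, h2, rfl⟩
  have hne : e ≠ emax eb := fun h => hb (hM' h)
  have hMe : |M| = 2^sb := by omega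
  obtain ⟨n, rfl⟩ := Nat.exists_eq_add_of_le hsb
  have hpn : (1:ℤ) ≤ 2 ^ n := one_le_pow₀ (by norm_num)
  have e1 : (2:ℤ)^(2+n) = 2 * 2^(n+1) := by ring
  have e2 : (2:ℤ)^(n+1) = 2 * 2^n := by ring
  have hz : (2:ℝ)^(e + 1 - ((2+n : ℕ):ℤ) + 1) = 2 * (2:ℝ)^(e - ((2+n : ℕ):ℤ) + 1) := by
    rw [show e + 1 - ((2+n : ℕ):ℤ) + 1 = (e - ((2+n : ℕ):ℤ) + 1) + 1 by ring,
      zpow_add₀ (by norm_num), zpow_one]; ring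
  have habs : |(2:ℤ)^(n+1)| = 2^(n+1) := abs_of_pos (by positivity)
  rcases (abs_eq (by positivity)).1 hMe with h | h
  · refine ⟨2^(n+1), e+1, by rw [habs]; omega, by omega, by omega, ?_⟩
    rw [hz, h, e1]; push_cast; ring
  · refine ⟨-2^(n+1), e+1, by rw [abs_neg, habs]; omega, by omega, by omega, ?_⟩
    rw [hz, h, e1]; push_cast; ring

theorem aux_up (eb sb : ℕ) (heb : 2 ≤ eb) (hsb : 2 ≤ sb) (w : ℝ) (hw : |w| ≤ maxF eb sb) :
    ∃ b ∈ Fset eb sb, w ≤ b ∧ b ≤ w + |w| / edc sb + emc eb sb := by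
  obtain ⟨e, h1, h2, h3, h4⟩ := aux_exp eb sb heb hsb w hw
  obtain ⟨hp, hd⟩ := aux_pow sb hsb
  rw [← aux_zpow sb hsb] at h4
  have hs : (0:ℝ) < (2:ℝ)^(e - (sb:ℤ) + 1) := by positivity
  have hse : (2:ℝ)^(e+1) = 2^sb * (2:ℝ)^(e - (sb:ℤ) + 1) := by
    rw [← zpow_natCast, ← zpow_add₀ (by norm_num)]; congr 1; ring
  -- bound on the ceiling from a bound on the value
  have key : ∀ K : ℤ, |w| ≤ (K:ℝ) * (2:ℝ)^(e - (sb:ℤ) + 1) →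
      |⌈w / (2:ℝ)^(e - (sb:ℤ) + 1)⌉| ≤ K := by
    intro K hK
    obtain ⟨ha, hb⟩ := abs_le.1 hK
    rw [abs_le]
    constructor
    · have : ((-K : ℤ) : ℝ) ≤ w / (2:ℝ)^(e - (sb:ℤ) + 1) := by
        rw [le_div_iff₀ hs]; push_cast; linarith
      exact_mod_cast this.trans (Int.le_ceil _)
    · rw [Int.ceil_le, div_le_iff₀ hs]; exact hb
  refine ⟨_, aux_mem eb sb heb hsb ⌈w / (2:ℝ)^(e - (sb:ℤ) + 1)⌉ e h1 h2 ?_ ?_, ?_, ?_⟩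
  · apply key; push_cast; rw [← hse]; exact h3
  · intro h; apply key; push_cast; rw [h]; exact hw
  · rw [← div_le_iff₀ hs]; exact Int.le_ceil _
  · have := (Int.ceil_lt_add_one (w / (2:ℝ)^(e - (sb:ℤ) + 1))).le
    have h5 := mul_le_mul_of_nonneg_right this hs.le
    rw [add_mul, div_mul_cancel₀ _ hs.ne'] at h5
    linarith

theorem stmt5 (eb sb : ℕ) (heb : 2 ≤ eb) (hsb : 2 ≤ sb)
    (xl x xu yl y yu : ℝ)
    (hx1 : xl ≤ x) (hx2 : x ≤ xu) (hy1 : yl ≤ y) (hy2 : y ≤ yu)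
    (hs1 : -maxF eb sb ≤ x - y) (hs2 : x - y ≤ maxF eb sb)
    (z : ℝ) (hz : DirRound eb sb (x - y) z) :
    Dr eb sb (xl - yu) ≤ z ∧ z ≤ Ur eb sb (xu - yl) := by
  have hv : xl - yu ≤ x - y := by linarith
  have hu : x - y ≤ xu - yl := by linarith
  generalize xl - yu = v at *
  generalize xu - yl = u at *
  generalize x - y = w at *
  have hw : |w| ≤ maxF eb sb := abs_le.2 ⟨hs1, hs2⟩
  obtain ⟨b, hbF, hb1, hb2⟩ := aux_up eb sb heb hsb w hw
  obtain ⟨a, haF, ha1, ha2⟩ := aux_up eb sb heb hsb (-w) (by rwa [abs_neg])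
  rw [abs_neg] at ha2
  obtain ⟨hp, hd⟩ := aux_pow sb hsb
  have hlip : ∀ p q : ℝ, p ≤ q → |(|p| / edc sb - |q| / edc sb)| ≤ q - p := by
    intro p q hpq
    rw [← sub_div, abs_div, abs_of_pos (by linarith : 0 < edc sb), div_le_iff₀ (by linarith)]
    have := abs_abs_sub_abs_le p q
    rw [abs_sub_comm p q, abs_of_nonneg (by linarith : 0 ≤ q - p)] at this
    nlinarith
  have l1 := abs_le.1 (hlip v w hv)
  have l2 := abs_le.1 (hlip w u hu)
  unfold Dr Ur
  rcases hz with hz | hz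
  · have h1 := hz.1.2
    have h2 := hz.2 ⟨aux_neg _ _ _ haF, by linarith⟩
    constructor <;> linarith
  · have h1 := hz.1.2
    have h2 := hz.2 ⟨hbF, hb1⟩
    constructor <;> linarith
end
end
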